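/- arXiv:2401.08974 — 2 statements merged into one kernel-verified Lean document; each statement's English description precedes it below -/
import Mathlib

section
/- Let s > 0, let v₁, v₂ > 0 with v₁ ≠ v₂, let μ ∈ ℝ, and define p_m = μ − s/v_m for m = 1, 2 and v̄ = (v₁ + v₂)/2. Assume p₁ > 0, p₂ > 0, and p₁·p₂ > 2s²/(v₁·v₂). Then log(1 + v̄·p₁/s) + log(1 + v̄·p₂/s) > log(1 + v₁·p₁/s) + log(1 + v₂·p₂/s). -/
/-- Exchange inequality: replacing two unequal gains by their average, while keeping the
water-filling powers, strictly increases the two-subcarrier sum rate in the high-SNR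
regime. -/
theorem gain_exchange_rate_increase (s v1 v2 μ : ℝ) (hs : 0 < s)
    (hv1 : 0 < v1) (hv2 : 0 < v2) (hne : v1 ≠ v2)
    (p1 p2 vbar : ℝ) (hp1 : p1 = μ - s / v1) (hp2 : p2 = μ - s / v2)
    (hvbar : vbar = (v1 + v2) / 2)
    (hp1pos : 0 < p1) (hp2pos : 0 < p2)
    (hSNR : p1 * p2 > 2 * s ^ 2 / (v1 * v2)) :
    Real.log (1 + vbar * p1 / s) + Real.log (1 + vbar * p2 / s) >
      Real.log (1 + v1 * p1 / s) + Real.log (1 + v2 * p2 / s) := by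
  have hd : 0 < (v1 - v2) ^ 2 := by
    have := sub_ne_zero.mpr hne
    positivity
  have hvpos : 0 < vbar := by rw [hvbar]; positivity
  have key : (1 + vbar * p1 / s) * (1 + vbar * p2 / s) -
      (1 + v1 * p1 / s) * (1 + v2 * p2 / s) =
      (v1 - v2) ^ 2 / (4 * s ^ 2) * (p1 * p2 - 2 * s ^ 2 / (v1 * v2)) := by
    rw [hvbar, hp1, hp2]
    field_simp
    ring
  have hgap : 0 < (v1 - v2) ^ 2 / (4 * s ^ 2) * (p1 * p2 - 2 * s ^ 2 / (v1 * v2)) :=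
    mul_pos (by positivity) (sub_pos.mpr hSNR)
  rw [gt_iff_lt, ← Real.log_mul (by positivity) (by positivity),
    ← Real.log_mul (by positivity) (by positivity)]
  exact Real.log_lt_log (by positivity) (by linarith)
end

section
/- Let M ≥ 2 be an integer and let G, P, s > 0 (s being the noise power σ²). Suppose (v, p) ∈ ℝ^M × ℝ^M satisfies: v_m > 0 and p_m > 0 for all m, Σ_{m=1}^M v_m ≤ M·G, Σ_{m=1}^M p_m ≤ P, there exists μ ∈ ℝ with p_m = μ − s/v_m for all m, and p_m·p_n > 2s²/(v_m·v_n) for all m ≠ n. If (v, p) maximizes the function f(v', p') = Σ_{m=1}^M log(1 + v'_m·p'_m/s) over the set of all pairs (v', p') with v'_m ≥ 0, Σ_m v'_m ≤ M·G, p'_m ≥ 0, Σ_m p'_m ≤ P, then v_m = v_n for all m, n ∈ {1, …, M}. -/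
open Finset

/-- Two sums whose terms agree away from two indices differ only by the terms at those indices. -/
theorem sum_sub_sum_eq_of_eq_off_pair {ι R : Type*} [Fintype ι] [AddCommGroup R]
    {m n : ι} (hmn : m ≠ n) (f g : ι → R) (h : ∀ k, k ≠ m → k ≠ n → f k = g k) :
    ∑ k, f k - ∑ k, g k = (f m - g m) + (f n - g n) := by
  classical
  rw [← Finset.sum_sub_distrib]
  exact Fintype.sum_eq_add m n hmn fun k hk => sub_eq_zero.mpr (h k hk.1 hk.2)

/-- At high SNR, averaging two distinct gains strictly increases the product of the
water-filled received powers. -/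
theorem mul_lt_mul_average_gain {s a b p q : ℝ} (ha : 0 < a) (hb : 0 < b) (hab : a ≠ b)
    (hwf : p + s / a = q + s / b) (hSNR : 2 * s ^ 2 / (a * b) < p * q) :
    (s + a * p) * (s + b * q) < (s + (a + b) / 2 * p) * (s + (a + b) / 2 * q) := by
  have hpq : p - q = s * (a - b) / (a * b) := by
    have h : p - q = s / b - s / a := by linarith
    rw [h]
    field_simp
  have hgain : (s + (a + b) / 2 * p) * (s + (a + b) / 2 * q) - (s + a * p) * (s + b * q)
      = (b - a) ^ 2 / 4 * (p * q - 2 * s ^ 2 / (a * b)) := by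
    calc
      _ = (b - a) / 2 * (s * (p - q) + p * q * (b - a) / 2) := by ring
      _ = _ := by rw [hpq]; ring
  have hsq : 0 < (b - a) ^ 2 := by
    have := sub_ne_zero.mpr hab.symm
    positivity
  have : 0 < (b - a) ^ 2 / 4 * (p * q - 2 * s ^ 2 / (a * b)) :=
    mul_pos (by linarith) (by linarith)
  linarith

/-- In the high-SNR regime, any maximizer of the relaxed achievable-rate problem must
equalize the channel power gains over all subcarriers. -/
theorem maximizer_equal_gains (M : ℕ) (hM : 2 ≤ M)
    (G P s : ℝ) (hG : 0 < G) (hP : 0 < P) (hs : 0 < s)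
    (v p : Fin M → ℝ)
    (hv : ∀ m, 0 < v m) (hp : ∀ m, 0 < p m)
    (hvsum : ∑ m, v m ≤ (M : ℝ) * G)
    (hpsum : ∑ m, p m ≤ P)
    (hwf : ∃ μ : ℝ, ∀ m, p m = μ - s / v m)
    (hSNR : ∀ m n : Fin M, m ≠ n → p m * p n > 2 * s ^ 2 / (v m * v n))
    (hmax : ∀ v' p' : Fin M → ℝ, (∀ m, 0 ≤ v' m) → (∑ m, v' m ≤ (M : ℝ) * G) →
      (∀ m, 0 ≤ p' m) → (∑ m, p' m ≤ P) →
      ∑ m, Real.log (1 + v' m * p' m / s) ≤ ∑ m, Real.log (1 + v m * p m / s)) :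
    ∀ m n : Fin M, v m = v n := by
  intro m n
  by_contra hne
  have hmn : m ≠ n := fun h => hne (congrArg v h)
  obtain ⟨μ, hμ⟩ := hwf
  have hlt := mul_lt_mul_average_gain (hv m) (hv n) hne
    (show p m + s / v m = p n + s / v n by rw [hμ m, hμ n]; ring) (hSNR m n hmn)
  set c := (v m + v n) / 2 with hc
  have hcpos : 0 < c := by linarith [hv m, hv n]
  let w : Fin M → ℝ := fun k => if k = m ∨ k = n then c else v k
  have hwm : w m = c := by simp [w]
  have hwn : w n = c := by simp [w]
  have hwk : ∀ k, k ≠ m → k ≠ n → w k = v k := fun k h₁ h₂ => by simp [w, h₁, h₂]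
  have hw : ∀ k, 0 ≤ w k := fun k => by
    simp only [w]
    split_ifs
    exacts [hcpos.le, (hv k).le]
  have hwsum := sum_sub_sum_eq_of_eq_off_pair hmn w v hwk
  rw [hwm, hwn] at hwsum
  have hle := hmax w p hw (by linarith) (fun k => (hp k).le) hpsum
  have hlog := sum_sub_sum_eq_of_eq_off_pair hmn
    (fun k => Real.log (1 + w k * p k / s)) (fun k => Real.log (1 + v k * p k / s))
    (fun k h₁ h₂ => by simp only [hwk k h₁ h₂])
  simp only [hwm, hwn] at hlog
  have hpos : ∀ x k, 0 < x → 0 < 1 + x * p k / s := fun x k hx => by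
    have := hp k
    positivity
  have hlogs : Real.log ((1 + v m * p m / s) * (1 + v n * p n / s))
      < Real.log ((1 + c * p m / s) * (1 + c * p n / s)) := by
    apply Real.log_lt_log (mul_pos (hpos _ m (hv m)) (hpos _ n (hv n)))
    have hfac : ∀ x y : ℝ, (1 + x / s) * (1 + y / s) = (s + x) * (s + y) / s ^ 2 :=
      fun x y => by field_simp
    rw [hfac, hfac]
    gcongr
  rw [Real.log_mul (hpos _ m (hv m)).ne' (hpos _ n (hv n)).ne',
    Real.log_mul (hpos _ m hcpos).ne' (hpos _ n hcpos).ne'] at hlogs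
  linarith
end
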